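/- arXiv:1209.4919 — 6 statements merged into one kernel-verified Lean document; each statement's English description precedes it below -/
import Mathlib

section
/- For every real α > −1 and every x > 0, the function I_α is twice differentiable at x and satisfies the modified Bessel equation x²·I_α''(x) + x·I_α'(x) − (x² + α²)·I_α(x) = 0. -/
open Real Filter Set

/-- The modified Bessel function of the first kind of order `α`, defined by its power
series, with `1/Γ` interpreted as `0` at the nonpositive-integer poles of `Γ`
(Mathlib's `Real.Gamma` vanishes there). -/
noncomputable def besselI (α : ℝ) (x : ℝ) : ℝ :=
  ∑' m : ℕ, 1 / ((m.factorial : ℝ) * Real.Gamma ((m : ℝ) + α + 1)) * (x / 2) ^ (2 * (m : ℝ) + α)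

/-- The series `∑ c m * (x / 2) ^ (2 * m + β)` of Frobenius type. -/
noncomputable def frobeniusSeries (c : ℕ → ℝ) (β x : ℝ) : ℝ :=
  ∑' m : ℕ, c m * (x / 2) ^ (2 * (m : ℝ) + β)

/-- The coefficient sequence of a power series with infinite radius of convergence. -/
def EntireCoeff (c : ℕ → ℝ) : Prop :=
  ∀ r : ℝ, 0 < r → Summable fun m => |c m| * r ^ m

lemma EntireCoeff.deriv_coeff {c : ℕ → ℝ} (hc : EntireCoeff c) (β : ℝ) :
    EntireCoeff fun m => c m * ((2 * (m : ℝ) + β) / 2) := by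
  intro r hr
  refine Summable.of_nonneg_of_le (fun m => by positivity) (fun m => ?_)
    ((hc (2 * r) (by positivity)).mul_left (1 + |β|))
  have h1 : |(2 * (m : ℝ) + β) / 2| ≤ (1 + |β|) * 2 ^ m := by
    have h2 : (m : ℝ) ≤ 2 ^ m := by exact_mod_cast Nat.lt_two_pow_self.le
    have h3 : (1 : ℝ) ≤ 2 ^ m := one_le_pow₀ (by norm_num)
    have h4 := mul_le_mul_of_nonneg_left h3 (abs_nonneg β)
    have h5 := neg_abs_le β
    have h6 := le_abs_self β
    have h7 : (0 : ℝ) ≤ m := m.cast_nonneg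
    rw [abs_le]
    constructor <;> nlinarith [abs_nonneg β]
  rw [abs_mul, mul_pow]
  calc |c m| * |(2 * (m : ℝ) + β) / 2| * r ^ m
      ≤ |c m| * ((1 + |β|) * 2 ^ m) * r ^ m := by gcongr
    _ = (1 + |β|) * (|c m| * (2 ^ m * r ^ m)) := by ring

lemma rpow_two_mul_natCast_add {y : ℝ} (hy : 0 < y) (m : ℕ) (β : ℝ) :
    y ^ (2 * (m : ℝ) + β) = (y ^ 2) ^ m * y ^ β := by
  rw [Real.rpow_add hy, ← pow_mul, ← Real.rpow_natCast]
  push_cast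
  rfl

lemma EntireCoeff.summable {c : ℕ → ℝ} (hc : EntireCoeff c) (β : ℝ) {x : ℝ} (hx : 0 < x) :
    Summable fun m : ℕ => c m * (x / 2) ^ (2 * (m : ℝ) + β) := by
  have hx2 : 0 < x / 2 := by positivity
  refine Summable.of_norm ?_
  refine ((hc ((x / 2) ^ 2) (by positivity)).mul_right ((x / 2) ^ β)).congr fun m => ?_
  rw [rpow_two_mul_natCast_add hx2, norm_mul, Real.norm_eq_abs, Real.norm_of_nonneg (by positivity),
    mul_assoc]

lemma rpow_le_rpow_add_rpow {a b y : ℝ} (ha : 0 < a) (hay : a ≤ y) (hyb : y ≤ b) (β : ℝ) :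
    y ^ β ≤ a ^ β + b ^ β := by
  have hy : 0 < y := ha.trans_le hay
  have hb : 0 < b := hy.trans_le hyb
  rcases le_total 0 β with h | h
  · exact (Real.rpow_le_rpow hy.le hyb h).trans (le_add_of_nonneg_left (by positivity))
  · exact (Real.rpow_le_rpow_of_nonpos ha hay h).trans (le_add_of_nonneg_right (by positivity))

lemma EntireCoeff.hasDerivAt_frobeniusSeries {c : ℕ → ℝ} (hc : EntireCoeff c) (β : ℝ) {x : ℝ}
    (hx : 0 < x) :
    HasDerivAt (frobeniusSeries c β)
      (frobeniusSeries (fun m => c m * ((2 * (m : ℝ) + β) / 2)) (β - 1) x) x := by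
  have hu := ((hc.deriv_coeff β) (x ^ 2) (by positivity)).mul_right
    ((x / 4) ^ (β - 1) + x ^ (β - 1))
  have hxm : x ∈ Ioo (x / 2) (2 * x) := ⟨by linarith, by linarith⟩
  refine hasDerivAt_tsum_of_isPreconnected
    (g := fun (m : ℕ) y => c m * (y / 2) ^ (2 * (m : ℝ) + β))
    (g' := fun (m : ℕ) y => c m * ((2 * (m : ℝ) + β) / 2) * (y / 2) ^ (2 * (m : ℝ) + (β - 1)))
    hu isOpen_Ioo isPreconnected_Ioo (fun m y hy => ?_) (fun m y hy => ?_) hxm (hc.summable β hx) hxm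
  · have hy0 : 0 < y := by linarith [hy.1]
    have h := (((hasDerivAt_id y).div_const 2).rpow_const (p := 2 * (m : ℝ) + β)
      (Or.inl (by simpa using hy0.ne'))).const_mul (c m)
    refine h.congr_deriv ?_
    rw [add_sub_assoc]
    simp only [id]
    ring
  · have hy0 : 0 < y / 2 := by linarith [hy.1]
    have h1 : y / 2 ≤ x := by linarith [hy.2]
    rw [rpow_two_mul_natCast_add hy0, norm_mul, Real.norm_eq_abs,
      Real.norm_of_nonneg (by positivity), mul_assoc]
    gcongr
    exact rpow_le_rpow_add_rpow (by positivity) (by linarith [hy.1]) h1 _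

lemma besselI_coeff_succ {α : ℝ} (hα : -1 < α) (m : ℕ) :
    ((m : ℝ) + 1) * (m + 1 + α) *
      (1 / (((m + 1).factorial : ℝ) * Real.Gamma (((m + 1 : ℕ) : ℝ) + α + 1))) =
    1 / ((m.factorial : ℝ) * Real.Gamma ((m : ℝ) + α + 1)) := by
  have hm : (0 : ℝ) ≤ m := m.cast_nonneg
  have h0 : 0 < (m : ℝ) + α + 1 := by linarith
  have hG := Real.Gamma_pos_of_pos h0
  have hf : (0 : ℝ) < m.factorial := by exact_mod_cast m.factorial_pos
  have e : ((m + 1 : ℕ) : ℝ) + α + 1 = ((m : ℝ) + α + 1) + 1 := by push_cast; ring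
  rw [e, Real.Gamma_add_one h0.ne', Nat.factorial_succ]
  push_cast
  field_simp
  ring

lemma entireCoeff_besselI {α : ℝ} (hα : -1 < α) :
    EntireCoeff fun m => 1 / ((m.factorial : ℝ) * Real.Gamma ((m : ℝ) + α + 1)) := by
  intro r hr
  have hpos : ∀ m : ℕ, 0 < 1 / ((m.factorial : ℝ) * Real.Gamma ((m : ℝ) + α + 1)) := by
    intro m
    have hm : (0 : ℝ) ≤ m := m.cast_nonneg
    have hG : 0 < Real.Gamma ((m : ℝ) + α + 1) := Real.Gamma_pos_of_pos (by linarith)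
    positivity
  have hlim : Tendsto (fun m : ℕ => r / (((m : ℝ) + 1) * (m + 1 + α))) atTop (nhds 0) := by
    refine Tendsto.const_div_atTop ?_ r
    refine Tendsto.atTop_mul_atTop₀ ?_ ?_
    · exact tendsto_atTop_add_const_right _ _ tendsto_natCast_atTop_atTop
    · exact tendsto_atTop_add_const_right _ _
        (tendsto_atTop_add_const_right _ _ tendsto_natCast_atTop_atTop)
  refine summable_of_ratio_test_tendsto_lt_one zero_lt_one
    (Eventually.of_forall fun m => (mul_pos (abs_pos.2 (hpos m).ne') (pow_pos hr m)).ne')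
    (hlim.congr fun m => ?_)
  have hm : (0 : ℝ) ≤ m := m.cast_nonneg
  have h1 : 0 < (m : ℝ) + 1 := by linarith
  have h2 : 0 < (m : ℝ) + 1 + α := by linarith
  have hp := hpos (m + 1)
  rw [abs_of_pos (hpos m), abs_of_pos hp, Real.norm_of_nonneg (by positivity),
    Real.norm_of_nonneg (mul_nonneg (hpos m).le (by positivity)), ← besselI_coeff_succ hα m]
  generalize 1 / (((m + 1).factorial : ℝ) * Real.Gamma (((m + 1 : ℕ) : ℝ) + α + 1)) = d at hp ⊢
  field_simp
  ring

/-- For `α > -1` and `x > 0`, `I_α` is twice differentiable at `x` and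
satisfies the modified Bessel equation `x² I_α'' + x I_α' - (x² + α²) I_α = 0`. -/
theorem besselI_solves_modified_bessel_ode (α : ℝ) (hα : -1 < α) (x : ℝ) (hx : 0 < x) :
    DifferentiableAt ℝ (besselI α) x ∧ DifferentiableAt ℝ (deriv (besselI α)) x ∧
    x ^ 2 * deriv (deriv (besselI α)) x + x * deriv (besselI α) x
      - (x ^ 2 + α ^ 2) * besselI α x = 0 := by
  set c : ℕ → ℝ := fun m => 1 / ((m.factorial : ℝ) * Real.Gamma ((m : ℝ) + α + 1))
  have hc : EntireCoeff c := entireCoeff_besselI hα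
  have hI : besselI α = frobeniusSeries c α := rfl
  have hc' := hc.deriv_coeff α
  have hc'' := hc'.deriv_coeff (α - 1)
  have hd : ∀ y, 0 < y → HasDerivAt (besselI α) _ y := fun y hy =>
    hI ▸ hc.hasDerivAt_frobeniusSeries α hy
  have heq : deriv (besselI α) =ᶠ[nhds x]
      frobeniusSeries (fun m => c m * ((2 * (m : ℝ) + α) / 2)) (α - 1) := by
    filter_upwards [Ioi_mem_nhds hx] with y hy using (hd y hy).deriv
  have hd2 := (hc'.hasDerivAt_frobeniusSeries (α - 1) hx).congr_of_eventuallyEq heq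
  refine ⟨(hd x hx).differentiableAt, hd2.differentiableAt, ?_⟩
  rw [hd2.deriv, (hd x hx).deriv, hI]
  have s0 := hc.summable α hx
  have s1 := hc'.summable (α - 1) hx
  have s2 := hc''.summable (α - 1 - 1) hx
  have hsum := ((s2.hasSum.mul_left (x ^ 2)).add (s1.hasSum.mul_left x)).sub
    (s0.hasSum.mul_left (α ^ 2))
  have hterm : ∀ m : ℕ, x ^ 2 * (c m * ((2 * (m : ℝ) + α) / 2) * ((2 * (m : ℝ) + (α - 1)) / 2) *
      (x / 2) ^ (2 * (m : ℝ) + (α - 1 - 1))) +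
      x * (c m * ((2 * (m : ℝ) + α) / 2) * (x / 2) ^ (2 * (m : ℝ) + (α - 1))) -
      α ^ 2 * (c m * (x / 2) ^ (2 * (m : ℝ) + α)) =
      4 * m * (m + α) * c m * (x / 2) ^ (2 * (m : ℝ) + α) := by
    intro m
    have hx2 : 0 < x / 2 := by positivity
    have e1 : 2 * (m : ℝ) + α = (2 * (m : ℝ) + (α - 1)) + 1 := by ring
    have e2 : 2 * (m : ℝ) + (α - 1) = (2 * (m : ℝ) + (α - 1 - 1)) + 1 := by ring
    have p1 : (x / 2) ^ (2 * (m : ℝ) + α) = (x / 2) ^ (2 * (m : ℝ) + (α - 1)) * (x / 2) := by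
      rw [e1, Real.rpow_add_one hx2.ne']
    have p2 : (x / 2) ^ (2 * (m : ℝ) + (α - 1)) =
        (x / 2) ^ (2 * (m : ℝ) + (α - 1 - 1)) * (x / 2) := by
      rw [e2, Real.rpow_add_one hx2.ne']
    rw [p1, p2]
    ring
  have hsucc : ∀ m : ℕ, 4 * ((m + 1 : ℕ) : ℝ) * (((m + 1 : ℕ) : ℝ) + α) * c (m + 1) *
      (x / 2) ^ (2 * ((m + 1 : ℕ) : ℝ) + α) =
      x ^ 2 * (c m * (x / 2) ^ (2 * (m : ℝ) + α)) := by
    intro m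
    have hx2 : 0 < x / 2 := by positivity
    have hcm : ((m : ℝ) + 1) * (m + 1 + α) * c (m + 1) = c m := besselI_coeff_succ hα m
    rw [rpow_two_mul_natCast_add hx2, rpow_two_mul_natCast_add hx2, ← hcm, pow_succ]
    push_cast
    ring
  simp only [hterm] at hsum
  rw [← hasSum_nat_add_iff' 1] at hsum
  simp only [hsucc] at hsum
  have key := hsum.unique (s0.hasSum.mul_left (x ^ 2))
  simp only [Finset.sum_range_one, Nat.cast_zero, mul_zero, zero_mul, sub_zero] at key
  simp only [frobeniusSeries]
  linear_combination key
end

section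
/- For every real α > −1/2, one has lim_{x→∞} √x·e^{x}·K_α(x) = √(π/2). -/
open Real Filter Set MeasureTheory

/-- The modified Bessel function of the second kind of order `α > -1/2`, defined on
`(0,∞)` by the integral representation
`K_α(x) = (Γ(1/2)(x/2)^α/Γ(α+1/2)) ∫_1^∞ e^{-xt}(t²-1)^{α-1/2} dt`. -/
noncomputable def besselK (α : ℝ) (x : ℝ) : ℝ :=
  Real.Gamma (1 / 2) * (x / 2) ^ α / Real.Gamma (α + 1 / 2) *
    ∫ t in Set.Ioi (1 : ℝ), Real.exp (-x * t) * (t ^ 2 - 1) ^ (α - 1 / 2)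

lemma setIntegral_Ioi_eq_setIntegral_Ioi_zero_comp_add (g : ℝ → ℝ) (a : ℝ) :
    ∫ t in Set.Ioi a, g t = ∫ u in Set.Ioi (0 : ℝ), g (u + a) := by
  have h := (measurePreserving_add_right (volume : Measure ℝ) a).setIntegral_preimage_emb
    (measurableEmbedding_addRight a) g (Set.Ioi a)
  simpa using h.symm

/-- The substitution `t = 1 + u / x` in the integral defining `besselK`. -/
lemma integral_exp_neg_mul_mul_sq_sub_one_rpow (β : ℝ) {x : ℝ} (hx : 0 < x) :
    ∫ t in Set.Ioi (1 : ℝ), Real.exp (-x * t) * (t ^ 2 - 1) ^ β =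
      Real.exp (-x) * x ^ (-(β + 1)) *
        ∫ u in Set.Ioi (0 : ℝ), Real.exp (-u) * u ^ β * (2 + u / x) ^ β := by
  rw [setIntegral_Ioi_eq_setIntegral_Ioi_zero_comp_add]
  have h := integral_comp_mul_left_Ioi
    (fun u => Real.exp (-u) * u ^ β * (2 + u / x) ^ β) 0 hx
  rw [mul_zero, smul_eq_mul, inv_mul_eq_div, eq_div_iff hx.ne'] at h
  rw [← h, ← integral_mul_const, ← integral_const_mul]
  refine setIntegral_congr_fun measurableSet_Ioi fun v hv => ?_
  have hv : 0 < v := hv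
  have hsq : (v + 1) ^ 2 - 1 = v * (2 + v) := by ring
  have hexp : Real.exp (-x * (v + 1)) = Real.exp (-x) * Real.exp (-(x * v)) := by
    rw [← Real.exp_add]; ring_nf
  have hpow : x ^ (-(β + 1)) * x ^ β * x = 1 := by
    rw [← Real.rpow_add hx, ← Real.rpow_add_one hx.ne']
    ring_nf
    exact Real.rpow_zero x
  rw [hsq, hexp, Real.mul_rpow hv.le (by positivity), Real.mul_rpow hx.le hv.le,
    mul_div_cancel_left₀ v hx.ne']
  linear_combination (-(Real.exp (-x) * Real.exp (-(x * v)) * v ^ β * (2 + v) ^ β)) * hpow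

lemma two_add_div_rpow_le (β : ℝ) {x u : ℝ} (hx : 1 ≤ x) (hu : 0 < u) :
    (2 + u / x) ^ β ≤ 4 ^ |β| + 2 ^ |β| * u ^ |β| := by
  have hux : u / x ≤ u := div_le_self hu.le hx
  have hux0 : 0 < u / x := by positivity
  have hβ : 0 ≤ |β| := abs_nonneg β
  calc (2 + u / x) ^ β ≤ (2 + u / x) ^ |β| :=
        Real.rpow_le_rpow_of_exponent_le (by linarith) (le_abs_self β)
    _ ≤ (2 + u) ^ |β| := Real.rpow_le_rpow (by positivity) (by linarith) hβ
    _ ≤ 4 ^ |β| + 2 ^ |β| * u ^ |β| := by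
      rw [← Real.mul_rpow zero_le_two hu.le]
      rcases le_total u 2 with h | h
      · exact (Real.rpow_le_rpow (by positivity) (by linarith) hβ).trans
          (le_add_of_nonneg_right (by positivity))
      · exact (Real.rpow_le_rpow (by positivity) (by linarith) hβ).trans
          (le_add_of_nonneg_left (by positivity))

lemma tendsto_integral_exp_neg_mul_rpow_mul_two_add_div_rpow {β : ℝ} (hβ : -1 < β) :
    Filter.Tendsto
      (fun x : ℝ => ∫ u in Set.Ioi (0 : ℝ), Real.exp (-u) * u ^ β * (2 + u / x) ^ β)
      Filter.atTop (nhds (2 ^ β * Real.Gamma (β + 1))) := by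
  have hlim : 2 ^ β * Real.Gamma (β + 1) =
      ∫ u in Set.Ioi (0 : ℝ), Real.exp (-u) * u ^ β * 2 ^ β := by
    rw [integral_mul_const, Real.Gamma_eq_integral (by linarith), add_sub_cancel_right, mul_comm]
  rw [hlim]
  refine tendsto_integral_filter_of_dominated_convergence
    (fun u => 4 ^ |β| * (Real.exp (-u) * u ^ β) +
      2 ^ |β| * (Real.exp (-u) * u ^ (β + |β|))) ?_ ?_ ?_ ?_
  · exact Filter.Eventually.of_forall fun x =>
      Measurable.aestronglyMeasurable (by fun_prop)
  · filter_upwards [Filter.eventually_ge_atTop (1 : ℝ)] with x hx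
    refine (ae_restrict_iff' measurableSet_Ioi).mpr (ae_of_all _ fun u hu => ?_)
    have hu : 0 < u := hu
    have hx0 : 0 < x := by linarith
    rw [Real.norm_of_nonneg (by positivity), Real.rpow_add hu]
    calc Real.exp (-u) * u ^ β * (2 + u / x) ^ β
        ≤ Real.exp (-u) * u ^ β * (4 ^ |β| + 2 ^ |β| * u ^ |β|) :=
          mul_le_mul_of_nonneg_left (two_add_div_rpow_le β hx hu) (by positivity)
      _ = _ := by ring
  · have h1 := Real.GammaIntegral_convergent (s := β + 1) (by linarith)
    have h2 := Real.GammaIntegral_convergent (s := β + |β| + 1)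
      (by linarith [neg_abs_le β])
    rw [add_sub_cancel_right] at h1 h2
    exact (h1.const_mul _).add (h2.const_mul _)
  · refine ae_of_all _ fun u => Filter.Tendsto.const_mul _ ?_
    have h : Filter.Tendsto (fun x : ℝ => 2 + u / x) Filter.atTop (nhds (2 + 0)) :=
      (Filter.Tendsto.const_div_atTop Filter.tendsto_id u).const_add 2
    rw [add_zero] at h
    exact h.rpow_const (Or.inl two_ne_zero)

/-- For `α > -1/2`, `lim_{x→∞} √x e^x K_α(x) = √(π/2)`. -/
theorem tendsto_sqrt_mul_exp_mul_besselK_atTop (α : ℝ) (hα : -(1 / 2) < α) :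
    Filter.Tendsto (fun x => Real.sqrt x * Real.exp x * besselK α x) Filter.atTop
      (nhds (Real.sqrt (Real.pi / 2))) := by
  have hΓ : Real.Gamma (α + 1 / 2) ≠ 0 := (Real.Gamma_pos_of_pos (by linarith)).ne'
  have h := (tendsto_integral_exp_neg_mul_rpow_mul_two_add_div_rpow
    (β := α - 1 / 2) (by linarith)).const_mul
    (Real.sqrt Real.pi * 2 ^ (-α) / Real.Gamma (α + 1 / 2))
  have hlim : Real.sqrt Real.pi * 2 ^ (-α) / Real.Gamma (α + 1 / 2) *
      (2 ^ (α - 1 / 2) * Real.Gamma (α - 1 / 2 + 1)) = Real.sqrt (Real.pi / 2) := by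
    have h2 : (2 : ℝ) ^ (-α) * 2 ^ (α - 1 / 2) = (Real.sqrt 2)⁻¹ := by
      rw [← Real.rpow_add two_pos, Real.sqrt_eq_rpow, ← Real.rpow_neg zero_le_two]
      ring_nf
    rw [show α - 1 / 2 + 1 = α + 1 / 2 by ring, Real.sqrt_div Real.pi_pos.le, div_eq_mul_inv √π,
      ← h2]
    generalize Real.Gamma (α + 1 / 2) = G at hΓ
    field_simp
  rw [hlim] at h
  refine h.congr' ?_
  filter_upwards [Filter.eventually_gt_atTop (0 : ℝ)] with x hx
  have hexp : Real.exp x * Real.exp (-x) = 1 := by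
    rw [← Real.exp_add, add_neg_cancel, Real.exp_zero]
  have hpow : Real.sqrt x * x ^ α * x ^ (-(α - 1 / 2 + 1)) = 1 := by
    rw [Real.sqrt_eq_rpow, ← Real.rpow_add hx, ← Real.rpow_add hx]
    ring_nf
    exact Real.rpow_zero x
  rw [besselK, integral_exp_neg_mul_mul_sq_sub_one_rpow _ hx, Real.Gamma_one_half_eq,
    Real.div_rpow hx.le zero_le_two, div_eq_mul_inv (x ^ α), ← Real.rpow_neg zero_le_two]
  set J := ∫ u in Set.Ioi (0 : ℝ), Real.exp (-u) * u ^ (α - 1 / 2) * (2 + u / x) ^ (α - 1 / 2)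
  calc √π * 2 ^ (-α) / Real.Gamma (α + 1 / 2) * J
      = √π * 2 ^ (-α) / Real.Gamma (α + 1 / 2) * J * (Real.exp x * Real.exp (-x)) *
          (Real.sqrt x * x ^ α * x ^ (-(α - 1 / 2 + 1))) := by rw [hexp, hpow, mul_one, mul_one]
    _ = _ := by ring
end

section
/- Let ν ∈ [−1,0), p > −1 and λ > 0, and set α := −ν/(p+1) (so α > 0). Then the function x ↦ x^{−ν/2}·K_α((√λ/(p+1))·x^{(p+1)/2}) is bounded on (0,∞); in particular it has finite limits as x → 0⁺ and as x → ∞. -/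
open Real Filter Set MeasureTheory

/-- The regularised Bessel integral: up to a constant factor it equals `y ^ α * K_α(y)`. -/
noncomputable def besselIntegral (α y : ℝ) : ℝ :=
  ∫ s in Ioi (0 : ℝ), exp (-(y + s)) * (s * (s + 2 * y)) ^ (α - 1 / 2)

lemma rpow_le_const_mul_exp_half {b w : ℝ} (hb : 0 ≤ b) (hw : 0 ≤ w) :
    w ^ b ≤ (2 * b + 2) ^ b * exp (w / 2) := by
  have hk : 0 < 2 * b + 2 := by linarith
  have h : w ≤ (2 * b + 2) * exp (w / (2 * b + 2)) := by
    have h1 := add_one_le_exp (w / (2 * b + 2))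
    have h2 : w = (2 * b + 2) * (w / (2 * b + 2)) := by field_simp
    nlinarith
  calc w ^ b ≤ ((2 * b + 2) * exp (w / (2 * b + 2))) ^ b := rpow_le_rpow hw h hb
    _ = (2 * b + 2) ^ b * exp (w / (2 * b + 2) * b) := by
      rw [mul_rpow hk.le (exp_pos _).le, ← exp_mul]
    _ ≤ (2 * b + 2) ^ b * exp (w / 2) := by
      gcongr
      rw [div_mul_eq_mul_div, div_le_div_iff₀ hk two_pos]
      nlinarith

lemma exists_besselIntegrand_bound {α : ℝ} (hα : 0 < α) :
    ∃ g : ℝ → ℝ, IntegrableOn g (Ioi 0) ∧ ∀ y : ℝ, 0 ≤ y → ∀ s : ℝ, 0 < s →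
      exp (-(y + s)) * (s * (s + 2 * y)) ^ (α - 1 / 2) ≤ exp (-y / 2) * g s := by
  rcases le_or_gt (1 / 2) α with h | h
  · have hb : 0 ≤ 2 * α - 1 := by linarith
    refine ⟨fun s => (2 * (2 * α - 1) + 2) ^ (2 * α - 1) * exp (-(1 / 2) * s), ?_, ?_⟩
    · exact (exp_neg_integrableOn_Ioi 0 (by norm_num : (0 : ℝ) < 1 / 2)).const_mul _
    · intro y hy s hs
      have h1 : (s * (s + 2 * y)) ^ (α - 1 / 2) ≤ (y + s) ^ (2 * α - 1) := by
        have h2 : (y + s) ^ (2 * α - 1) = ((y + s) ^ (2 : ℝ)) ^ (α - 1 / 2) := by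
          rw [← rpow_mul (by positivity)]; congr 1; ring
        rw [h2, rpow_two]
        exact rpow_le_rpow (by positivity) (by nlinarith [sq_nonneg y]) (by linarith)
      calc exp (-(y + s)) * (s * (s + 2 * y)) ^ (α - 1 / 2)
          ≤ exp (-(y + s)) * ((2 * (2 * α - 1) + 2) ^ (2 * α - 1) * exp ((y + s) / 2)) := by
            gcongr
            exact h1.trans (rpow_le_const_mul_exp_half hb (by positivity))
        _ = (2 * (2 * α - 1) + 2) ^ (2 * α - 1) * exp (-(y + s) + (y + s) / 2) := by
            rw [exp_add]; ring
        _ = (2 * (2 * α - 1) + 2) ^ (2 * α - 1) * exp (-y / 2 + -(1 / 2) * s) := by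
            congr 2; ring
        _ = _ := by rw [exp_add]; ring
  · refine ⟨fun s => exp (-s) * s ^ (2 * α - 1), GammaIntegral_convergent (by positivity), ?_⟩
    intro y hy s hs
    have h1 : (s * (s + 2 * y)) ^ (α - 1 / 2) ≤ s ^ (2 * α - 1) := by
      have h2 : s ^ (2 * α - 1) = (s ^ (2 : ℝ)) ^ (α - 1 / 2) := by
        rw [← rpow_mul hs.le]; congr 1; ring
      rw [h2, rpow_two]
      exact rpow_le_rpow_of_nonpos (by positivity) (by nlinarith) (by linarith)
    calc exp (-(y + s)) * (s * (s + 2 * y)) ^ (α - 1 / 2)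
        ≤ exp (-y / 2 + -s) * s ^ (2 * α - 1) := by
          gcongr
          linarith
      _ = _ := by rw [exp_add]; ring

lemma besselIntegrand_nonneg (α : ℝ) {y s : ℝ} (hy : 0 ≤ y) (hs : 0 < s) :
    0 ≤ exp (-(y + s)) * (s * (s + 2 * y)) ^ (α - 1 / 2) := by
  positivity

lemma exists_besselIntegral_bound {α : ℝ} (hα : 0 < α) :
    ∃ C : ℝ, ∀ y : ℝ, 0 ≤ y → |besselIntegral α y| ≤ C * exp (-y / 2) := by
  obtain ⟨g, hg, hle⟩ := exists_besselIntegrand_bound hα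
  refine ⟨∫ s in Ioi (0 : ℝ), g s, fun y hy => ?_⟩
  rw [mul_comm, ← integral_const_mul, ← norm_eq_abs]
  refine norm_integral_le_of_norm_le (hg.const_mul _) ?_
  filter_upwards [ae_restrict_mem measurableSet_Ioi] with s hs
  rw [norm_eq_abs, abs_of_nonneg (besselIntegrand_nonneg α hy hs)]
  exact hle y hy s hs

lemma tendsto_besselIntegral_nhdsGT_zero {α : ℝ} (hα : 0 < α) :
    Tendsto (besselIntegral α) (nhdsWithin 0 (Ioi 0)) (nhds (besselIntegral α 0)) := by
  obtain ⟨g, hg, hle⟩ := exists_besselIntegrand_bound hα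
  refine tendsto_integral_filter_of_dominated_convergence g ?_ ?_ hg ?_
  · exact Eventually.of_forall fun y => (by fun_prop : Measurable _).aestronglyMeasurable
  · filter_upwards [self_mem_nhdsWithin] with y hy
    rw [mem_Ioi] at hy
    filter_upwards [ae_restrict_mem measurableSet_Ioi] with s hs
    have hnn := besselIntegrand_nonneg α hy.le hs
    have hb := hle y hy.le s hs
    rw [norm_eq_abs, abs_of_nonneg hnn]
    have hg0 : 0 ≤ g s := nonneg_of_mul_nonneg_right (hnn.trans hb) (exp_pos _)
    exact hb.trans (mul_le_of_le_one_left hg0 (exp_le_one_iff.2 (by linarith)))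
  · filter_upwards [ae_restrict_mem measurableSet_Ioi] with s hs
    rw [mem_Ioi] at hs
    refine Tendsto.mono_left (ContinuousAt.tendsto ?_) nhdsWithin_le_nhds
    refine ContinuousAt.mul (by fun_prop) (ContinuousAt.rpow_const (by fun_prop) (Or.inl ?_))
    positivity

lemma tendsto_besselIntegral_atTop {α : ℝ} (hα : 0 < α) :
    Tendsto (besselIntegral α) atTop (nhds 0) := by
  obtain ⟨C, hC⟩ := exists_besselIntegral_bound hα
  have h : Tendsto (fun y : ℝ => C * exp (-y / 2)) atTop (nhds 0) := by
    have h1 : Tendsto (fun y : ℝ => -y / 2) atTop atBot :=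
      tendsto_neg_atTop_atBot.atBot_div_const two_pos
    simpa using (tendsto_exp_atBot.comp h1).const_mul C
  refine squeeze_zero_norm' ?_ h
  filter_upwards [eventually_ge_atTop 0] with y hy using hC y hy

/-- The substitution `t = 1 + s / y` in the integral defining `besselK`. -/
lemma integral_exp_mul_sq_sub_one_rpow (α : ℝ) {y : ℝ} (hy : 0 < y) :
    ∫ t in Ioi (1 : ℝ), exp (-y * t) * (t ^ 2 - 1) ^ (α - 1 / 2) =
      y ^ (-(2 * α)) * besselIntegral α y := by
  have hshift : ∫ t in Ioi (1 : ℝ), exp (-y * t) * (t ^ 2 - 1) ^ (α - 1 / 2) =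
      ∫ t in Ioi (0 : ℝ), exp (-y * (t + 1)) * ((t + 1) ^ 2 - 1) ^ (α - 1 / 2) := by
    have h := (measurePreserving_add_right (volume : Measure ℝ) 1).setIntegral_preimage_emb
      (measurableEmbedding_addRight 1)
      (fun t : ℝ => exp (-y * t) * (t ^ 2 - 1) ^ (α - 1 / 2)) (Ioi 1)
    simpa using h.symm
  have hscale := integral_comp_mul_left_Ioi
    (fun s : ℝ => exp (-(y + s)) * (s * (s + 2 * y)) ^ (α - 1 / 2)) 0 hy
  rw [mul_zero, smul_eq_mul] at hscale
  have hI : besselIntegral α y =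
      y * ∫ t in Ioi (0 : ℝ), exp (-(y + y * t)) * (y * t * (y * t + 2 * y)) ^ (α - 1 / 2) := by
    rw [hscale, besselIntegral]; field_simp
  rw [hI, hshift, ← mul_assoc, ← integral_const_mul]
  refine setIntegral_congr_fun measurableSet_Ioi fun t ht => ?_
  rw [mem_Ioi] at ht
  have h1 : y * t * (y * t + 2 * y) = y ^ (2 : ℝ) * ((t + 1) ^ 2 - 1) := by
    rw [rpow_two]; ring
  have h2 : y ^ (-(2 * α)) * y * y ^ (2 * (α - 1 / 2)) = 1 := by
    rw [← rpow_add_one hy.ne', ← rpow_add hy]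
    ring_nf
    exact rpow_zero y
  have h3 : -(y + y * t) = -y * (t + 1) := by ring
  have h4 : (0 : ℝ) ≤ (t + 1) ^ 2 - 1 := by nlinarith
  rw [h1, mul_rpow (by positivity) h4, ← rpow_mul hy.le, h3]
  linear_combination (-(exp (-y * (t + 1)) * ((t + 1) ^ 2 - 1) ^ (α - 1 / 2))) * h2

lemma rpow_mul_besselK (α : ℝ) {y : ℝ} (hy : 0 < y) :
    y ^ α * besselK α y =
      Gamma (1 / 2) / (2 ^ α * Gamma (α + 1 / 2)) * besselIntegral α y := by
  have h : y ^ α * y ^ α * y ^ (-(2 * α)) = 1 := by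
    rw [← rpow_add hy, ← rpow_add hy]
    ring_nf
    exact rpow_zero y
  rw [besselK, integral_exp_mul_sq_sub_one_rpow α hy, div_rpow hy.le two_pos.le]
  linear_combination (Gamma (1 / 2) / (2 ^ α * Gamma (α + 1 / 2)) * besselIntegral α y) * h

/-- For `ν ∈ [-1,0)`, `p > -1`, `λ > 0` and `α = -ν/(p+1) > 0`, the
function `x ↦ x^{-ν/2} K_α((√λ/(p+1)) x^{(p+1)/2})` is bounded on `(0,∞)`; in
particular it has finite limits as `x → 0⁺` and as `x → ∞`. -/
theorem besselK_transform_bounded (ν p lam : ℝ) (hν : ν ∈ Set.Ico (-1 : ℝ) 0)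
    (hp : -1 < p) (hlam : 0 < lam) :
    (∃ C : ℝ, ∀ x ∈ Set.Ioi (0 : ℝ),
        |x ^ (-ν / 2) * besselK (-ν / (p + 1)) (Real.sqrt lam / (p + 1) * x ^ ((p + 1) / 2))|
          ≤ C) ∧
    (∃ l₀ : ℝ, Filter.Tendsto
        (fun x => x ^ (-ν / 2) * besselK (-ν / (p + 1)) (Real.sqrt lam / (p + 1) * x ^ ((p + 1) / 2)))
        (nhdsWithin 0 (Set.Ioi 0)) (nhds l₀)) ∧
    (∃ l₁ : ℝ, Filter.Tendsto
        (fun x => x ^ (-ν / 2) * besselK (-ν / (p + 1)) (Real.sqrt lam / (p + 1) * x ^ ((p + 1) / 2)))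
        Filter.atTop (nhds l₁)) := by
  have hq : 0 < p + 1 := by linarith
  set α : ℝ := -ν / (p + 1) with hα_def
  set c : ℝ := √lam / (p + 1) with hc_def
  have hα : 0 < α := div_pos (by linarith [hν.2]) hq
  have hc : 0 < c := div_pos (sqrt_pos.2 hlam) hq
  set D : ℝ := (c ^ α)⁻¹ * (Gamma (1 / 2) / (2 ^ α * Gamma (α + 1 / 2)))
  have key : ∀ x ∈ Ioi (0 : ℝ), x ^ (-ν / 2) * besselK α (c * x ^ ((p + 1) / 2)) =
      D * besselIntegral α (c * x ^ ((p + 1) / 2)) := by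
    intro x hx
    rw [mem_Ioi] at hx
    have hy : 0 < c * x ^ ((p + 1) / 2) := by positivity
    have hexp : (p + 1) / 2 * α = -ν / 2 := by rw [hα_def]; field_simp
    have h := rpow_mul_besselK α hy
    rw [mul_rpow hc.le (by positivity), ← rpow_mul hx.le, hexp] at h
    rw [mul_assoc, ← h]
    have hcα : c ^ α ≠ 0 := (rpow_pos_of_pos hc α).ne'
    field_simp
  have hpow : 0 < (p + 1) / 2 := by positivity
  refine ⟨?_, ⟨D * besselIntegral α 0, ?_⟩, ⟨D * 0, ?_⟩⟩
  · obtain ⟨C, hC⟩ := exists_besselIntegral_bound hα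
    have hC0 : 0 ≤ C := by simpa using (abs_nonneg _).trans (hC 0 le_rfl)
    refine ⟨|D| * C, fun x hx => ?_⟩
    have hy : 0 ≤ c * x ^ ((p + 1) / 2) := mul_nonneg hc.le (rpow_nonneg (le_of_lt hx) _)
    rw [key x hx, abs_mul]
    gcongr
    exact (hC _ hy).trans (mul_le_of_le_one_right hC0 (exp_le_one_iff.2 (by linarith)))
  · have hlim : Tendsto (fun x : ℝ => c * x ^ ((p + 1) / 2)) (nhdsWithin 0 (Ioi 0))
        (nhdsWithin 0 (Ioi 0)) := by
      refine tendsto_nhdsWithin_iff.2 ⟨?_, ?_⟩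
      · have h := ((continuousAt_rpow_const 0 _ (Or.inr hpow.le)).tendsto.const_mul c).mono_left
          (nhdsWithin_le_nhds (s := Ioi (0 : ℝ)))
        rwa [zero_rpow hpow.ne', mul_zero] at h
      · filter_upwards [self_mem_nhdsWithin] with x hx
        exact mul_pos hc (rpow_pos_of_pos hx _)
    refine (((tendsto_besselIntegral_nhdsGT_zero hα).comp hlim).const_mul D).congr' ?_
    filter_upwards [self_mem_nhdsWithin] with x hx using (key x hx).symm
  · have hlim : Tendsto (fun x : ℝ => c * x ^ ((p + 1) / 2)) atTop atTop :=
      (tendsto_rpow_atTop hpow).const_mul_atTop hc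
    refine (((tendsto_besselIntegral_atTop hα).comp hlim).const_mul D).congr' ?_
    filter_upwards [eventually_gt_atTop 0] with x hx using (key x hx).symm
end

section
/- Let ν ∈ [−1,0), p > −1 and λ > 0, and set α := −ν/(p+1) (so α > 0). Then the function x ↦ x^{−ν}·K_α((√λ/(p+1))·x^{p+1}) is decreasing (antitone) on (0,∞). -/
open Real Filter Set MeasureTheory

/-- The substitution `t = √(u² + z²) / z` maps `(0,∞)` onto `(1,∞)`. -/
lemma image_sqrt_sq_add_sq_div {z : ℝ} (hz : 0 < z) :
    Set.image (fun u : ℝ => √(u ^ 2 + z ^ 2) / z) (Ioi 0) = Ioi 1 := by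
  ext t
  simp only [mem_image, mem_Ioi]
  constructor
  · rintro ⟨u, hu, rfl⟩
    rw [one_lt_div hz]
    exact Real.lt_sqrt_of_sq_lt (by nlinarith)
  · intro ht
    have h : 0 < t ^ 2 - 1 := by nlinarith
    refine ⟨z * √(t ^ 2 - 1), by positivity, ?_⟩
    rw [mul_pow, Real.sq_sqrt h.le, show z ^ 2 * (t ^ 2 - 1) + z ^ 2 = (z * t) ^ 2 by ring,
      Real.sqrt_sq (by positivity)]
    field_simp

lemma injOn_sqrt_sq_add_sq_div {z : ℝ} (hz : 0 < z) :
    InjOn (fun u : ℝ => √(u ^ 2 + z ^ 2) / z) (Ioi 0) := by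
  intro u hu v hv h
  simp only [mem_Ioi] at hu hv
  have h1 : √(u ^ 2 + z ^ 2) = √(v ^ 2 + z ^ 2) := (div_left_inj' hz.ne').mp h
  rw [Real.sqrt_inj (by positivity) (by positivity)] at h1
  exact (sq_eq_sq₀ hu.le hv.le).mp (by linarith)

lemma hasDerivAt_sqrt_sq_add_sq_div {z : ℝ} (hz : 0 < z) (u : ℝ) :
    HasDerivAt (fun u : ℝ => √(u ^ 2 + z ^ 2) / z) (u / (z * √(u ^ 2 + z ^ 2))) u := by
  have hpos : 0 < u ^ 2 + z ^ 2 := by positivity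
  have hs : 0 < √(u ^ 2 + z ^ 2) := Real.sqrt_pos.mpr hpos
  refine ((((hasDerivAt_pow 2 u).add_const (z ^ 2)).sqrt hpos.ne').div_const z).congr_deriv ?_
  field_simp
  simp

/-- An integral representation of `z ^ α * K_α(z)`, up to a constant, whose integrand is
decreasing in `z`. -/
lemma rpow_mul_integral_exp_mul_sq_sub_one {z : ℝ} (hz : 0 < z) (α : ℝ) :
    z ^ (2 * α) * ∫ t in Ioi (1 : ℝ), exp (-z * t) * (t ^ 2 - 1) ^ (α - 1 / 2) =
      ∫ u in Ioi (0 : ℝ), exp (-√(u ^ 2 + z ^ 2)) * u ^ (2 * α) / √(u ^ 2 + z ^ 2) := by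
  rw [← image_sqrt_sq_add_sq_div hz,
    integral_image_eq_integral_abs_deriv_smul measurableSet_Ioi
      (fun u _ => (hasDerivAt_sqrt_sq_add_sq_div hz u).hasDerivWithinAt)
      (injOn_sqrt_sq_add_sq_div hz), ← integral_const_mul]
  refine setIntegral_congr_fun measurableSet_Ioi fun u hu => ?_
  simp only [mem_Ioi] at hu
  have hs : 0 < √(u ^ 2 + z ^ 2) := Real.sqrt_pos.mpr (by positivity)
  have hsq : (√(u ^ 2 + z ^ 2) / z) ^ 2 - 1 = (u / z) ^ (2 : ℝ) := by
    rw [div_pow, Real.sq_sqrt (by positivity), Real.rpow_two]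
    field_simp
    ring
  have hpow : ((u / z) ^ (2 : ℝ)) ^ (α - 1 / 2) = u ^ (2 * α) / z ^ (2 * α) * (z / u) := by
    rw [← Real.rpow_mul (by positivity), show 2 * (α - 1 / 2) = 2 * α - 1 by ring,
      Real.rpow_sub_one (by positivity), Real.div_rpow hu.le hz.le]
    field_simp
  have hexp : -z * (√(u ^ 2 + z ^ 2) / z) = -√(u ^ 2 + z ^ 2) := by field_simp
  have hz' : 0 < z ^ (2 * α) := by positivity
  simp only [smul_eq_mul]
  rw [abs_of_pos (by positivity), hsq, hpow, hexp]
  field_simp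

lemma integrableOn_exp_neg_sqrt_mul_rpow_div {z α : ℝ} (hz : 0 < z) (hα : 0 < α) :
    IntegrableOn (fun u : ℝ => exp (-√(u ^ 2 + z ^ 2)) * u ^ (2 * α) / √(u ^ 2 + z ^ 2))
      (Ioi 0) := by
  have hΓ := (Real.GammaIntegral_convergent (s := 2 * α + 1) (by positivity)).div_const z
  refine hΓ.mono' (Measurable.aestronglyMeasurable (by fun_prop)) ?_
  refine (ae_restrict_iff' measurableSet_Ioi).mpr (.of_forall fun u hu => ?_)
  simp only [mem_Ioi] at hu
  have hu' : u ≤ √(u ^ 2 + z ^ 2) := Real.le_sqrt_of_sq_le (by nlinarith)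
  have hz' : z ≤ √(u ^ 2 + z ^ 2) := Real.le_sqrt_of_sq_le (by nlinarith)
  rw [Real.norm_of_nonneg (by positivity), add_sub_cancel_right]
  gcongr

lemma antitoneOn_rpow_mul_integral_exp_mul_sq_sub_one {α : ℝ} (hα : 0 < α) :
    AntitoneOn (fun z : ℝ =>
      z ^ (2 * α) * ∫ t in Ioi (1 : ℝ), exp (-z * t) * (t ^ 2 - 1) ^ (α - 1 / 2)) (Ioi 0) := by
  intro z hz w hw hzw
  simp only [mem_Ioi] at hz hw
  simp only [rpow_mul_integral_exp_mul_sq_sub_one hz, rpow_mul_integral_exp_mul_sq_sub_one hw]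
  refine setIntegral_mono_on (integrableOn_exp_neg_sqrt_mul_rpow_div hw hα)
    (integrableOn_exp_neg_sqrt_mul_rpow_div hz hα) measurableSet_Ioi fun u hu => ?_
  simp only [mem_Ioi] at hu
  have hs : 0 < √(u ^ 2 + z ^ 2) := Real.sqrt_pos.mpr (by positivity)
  gcongr

lemma antitoneOn_rpow_mul_besselK {α : ℝ} (hα : 0 < α) :
    AntitoneOn (fun z : ℝ => z ^ α * besselK α z) (Ioi 0) := by
  have hC : 0 ≤ Real.Gamma (1 / 2) / (2 ^ α * Real.Gamma (α + 1 / 2)) := by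
    have := Real.Gamma_pos_of_pos (s := 1 / 2) (by norm_num)
    have := Real.Gamma_pos_of_pos (s := α + 1 / 2) (by positivity)
    positivity
  have key : EqOn (fun z : ℝ => Real.Gamma (1 / 2) / (2 ^ α * Real.Gamma (α + 1 / 2)) *
      (z ^ (2 * α) * ∫ t in Ioi (1 : ℝ), exp (-z * t) * (t ^ 2 - 1) ^ (α - 1 / 2)))
      (fun z : ℝ => z ^ α * besselK α z) (Ioi 0) := by
    intro z hz
    simp only [mem_Ioi] at hz
    simp only [besselK]
    rw [Real.div_rpow hz.le two_pos.le, two_mul, Real.rpow_add hz]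
    ring
  exact AntitoneOn.congr (fun z hz w hw hzw => mul_le_mul_of_nonneg_left
    (antitoneOn_rpow_mul_integral_exp_mul_sq_sub_one hα hz hw hzw) hC) key

/-- For `ν ∈ [-1,0)`, `p > -1`, `λ > 0` and `α = -ν/(p+1) > 0`, the
function `x ↦ x^{-ν} K_α((√λ/(p+1)) x^{p+1})` is decreasing (antitone) on `(0,∞)`. -/
theorem besselK_transform_antitoneOn (ν p lam : ℝ) (hν : ν ∈ Set.Ico (-1 : ℝ) 0)
    (hp : -1 < p) (hlam : 0 < lam) :
    AntitoneOn
      (fun x => x ^ (-ν) * besselK (-ν / (p + 1)) (Real.sqrt lam / (p + 1) * x ^ (p + 1)))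
      (Set.Ioi 0) := by
  have hp' : 0 < p + 1 := by linarith
  have hα : 0 < -ν / (p + 1) := div_pos (neg_pos.mpr hν.2) hp'
  set α := -ν / (p + 1) with hα_def
  have hc : 0 < √lam / (p + 1) := div_pos (Real.sqrt_pos.mpr hlam) hp'
  set c := √lam / (p + 1)
  have hmono : MonotoneOn (fun x : ℝ => c * x ^ (p + 1)) (Ioi 0) := by
    intro x hx y _ hxy
    simp only [mem_Ioi] at hx
    dsimp only
    gcongr
  have hmaps : MapsTo (fun x : ℝ => c * x ^ (p + 1)) (Ioi 0) (Ioi 0) := fun x hx =>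
    mul_pos hc (Real.rpow_pos_of_pos hx _)
  have hcα : 0 < c ^ α := by positivity
  have key : EqOn (fun x : ℝ => (c ^ α)⁻¹ *
      ((c * x ^ (p + 1)) ^ α * besselK α (c * x ^ (p + 1))))
      (fun x => x ^ (-ν) * besselK α (c * x ^ (p + 1))) (Ioi 0) := by
    intro x hx
    simp only [mem_Ioi] at hx
    have hexp : (p + 1) * α = -ν := by rw [hα_def]; field_simp
    dsimp only
    rw [Real.mul_rpow hc.le (by positivity), ← Real.rpow_mul hx.le, hexp]
    field_simp
  exact AntitoneOn.congr (fun x hx y hy hxy => mul_le_mul_of_nonneg_left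
    (antitoneOn_rpow_mul_besselK hα (hmaps hx) (hmaps hy) (hmono hx hy hxy))
    (inv_nonneg.mpr hcα.le)) key
end

section
/- For every real α > −1, one has lim_{x→∞} (log I_α(x))/x = 1. -/
open Real Filter Set

lemma factorial_two_mul_le_four_pow_mul (m : ℕ) :
    (2 * m).factorial ≤ 4 ^ m * (m.factorial * m.factorial) := by
  induction m with
  | zero => simp
  | succ m ih =>
    rw [show 2 * (m + 1) = 2 * m + 1 + 1 by ring, Nat.factorial_succ, Nat.factorial_succ,
      Nat.factorial_succ m]
    calc (2 * m + 1 + 1) * ((2 * m + 1) * (2 * m).factorial)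
        ≤ (2 * m + 1 + 1) * ((2 * m + 2) * (4 ^ m * (m.factorial * m.factorial))) := by
          gcongr; omega
      _ = _ := by ring

lemma four_pow_mul_factorial_mul_factorial_add_le (m k : ℕ) :
    4 ^ m * (m.factorial * (m + k).factorial) ≤ (2 * m + 1 + k).factorial := by
  induction k with
  | zero =>
    induction m with
    | zero => simp
    | succ m ih =>
      simp only [Nat.add_zero] at ih ⊢
      rw [show 2 * (m + 1) + 1 = 2 * m + 1 + 1 + 1 by ring, Nat.factorial_succ (2 * m + 1 + 1),
        Nat.factorial_succ (2 * m + 1), Nat.factorial_succ m]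
      calc 4 ^ (m + 1) * ((m + 1) * m.factorial * ((m + 1) * m.factorial))
          = (2 * m + 2) * ((2 * m + 2) * (4 ^ m * (m.factorial * m.factorial))) := by ring
        _ ≤ (2 * m + 1 + 1 + 1) * ((2 * m + 1 + 1) * (2 * m + 1).factorial) :=
          Nat.mul_le_mul (by omega) (Nat.mul_le_mul le_rfl ih)
  | succ k ih =>
    rw [← add_assoc, ← add_assoc, Nat.factorial_succ (m + k), Nat.factorial_succ (2 * m + 1 + k)]
    calc 4 ^ m * (m.factorial * ((m + k + 1) * (m + k).factorial))
        = (m + k + 1) * (4 ^ m * (m.factorial * (m + k).factorial)) := by ring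
      _ ≤ (2 * m + 1 + k + 1) * (2 * m + 1 + k).factorial := by
        gcongr; omega

lemma Gamma_mul_factorial_le_Gamma_nat_add {s : ℝ} (hs : 1 ≤ s) (m : ℕ) :
    Real.Gamma s * m.factorial ≤ Real.Gamma (m + s) := by
  induction m with
  | zero => simp
  | succ m ih =>
    have hm : (0 : ℝ) ≤ m := m.cast_nonneg
    have hG : 0 ≤ Real.Gamma s := (Real.Gamma_pos_of_pos (by linarith)).le
    rw [show ((m + 1 : ℕ) : ℝ) + s = (m + s) + 1 by push_cast; ring,
      Real.Gamma_add_one (by linarith), Nat.factorial_succ]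
    calc Real.Gamma s * ((m + 1) * m.factorial : ℕ)
        = (m + 1) * (Real.Gamma s * m.factorial) := by push_cast; ring
      _ ≤ (m + s) * Real.Gamma (m + s) := by gcongr

lemma Gamma_nat_add_le_Gamma_mul_factorial {s : ℝ} (hs : 0 < s) {k : ℕ} (hk : s ≤ k + 1) (m : ℕ) :
    Real.Gamma (m + s) ≤ Real.Gamma s * (m + k).factorial := by
  have hG : 0 < Real.Gamma s := Real.Gamma_pos_of_pos hs
  induction m with
  | zero =>
    have : (1 : ℝ) ≤ k.factorial := by exact_mod_cast k.factorial_pos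
    simpa using le_mul_of_one_le_right hG.le this
  | succ m ih =>
    have hm : (0 : ℝ) ≤ m := m.cast_nonneg
    rw [show ((m + 1 : ℕ) : ℝ) + s = (m + s) + 1 by push_cast; ring,
      Real.Gamma_add_one (by linarith), show m + 1 + k = m + k + 1 by ring, Nat.factorial_succ]
    calc (m + s) * Real.Gamma (m + s)
        ≤ (m + k + 1) * (Real.Gamma s * (m + k).factorial) := by gcongr ?_ * ?_; linarith
      _ = Real.Gamma s * ((m + k + 1) * (m + k).factorial : ℕ) := by push_cast; ring

lemma besselI_eq_rpow_mul_tsum (α : ℝ) {x : ℝ} (hx : 0 < x) :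
    besselI α x = (x / 2) ^ α *
      ∑' m : ℕ, (x / 2) ^ (2 * m) / ((m.factorial : ℝ) * Real.Gamma (m + (α + 1))) := by
  rw [besselI, ← tsum_mul_left]
  congr 1 with m
  rw [Real.rpow_add (by positivity), ← add_assoc]
  have : (x / 2) ^ (2 * (m : ℝ)) = (x / 2) ^ (2 * m) := by
    rw [← Real.rpow_natCast]; push_cast; rfl
  rw [this]
  ring

lemma besselI_coeff_le {α : ℝ} (hα : -1 < α) (x : ℝ) (m : ℕ) :
    (x / 2) ^ (2 * m) / ((m.factorial : ℝ) * Real.Gamma (m + (α + 1))) ≤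
      (Real.Gamma (α + 2))⁻¹ * ((m + (α + 1)) * (x ^ (2 * m) / (2 * m).factorial)) := by
  have hm : (0 : ℝ) ≤ m := m.cast_nonneg
  have hG : 0 < Real.Gamma (α + 2) := Real.Gamma_pos_of_pos (by linarith)
  have hGm : 0 < Real.Gamma (m + (α + 1)) := Real.Gamma_pos_of_pos (by linarith)
  have hs : 0 < (m : ℝ) + (α + 1) := by linarith
  have hrec : Real.Gamma (α + 2) * m.factorial ≤ (m + (α + 1)) * Real.Gamma (m + (α + 1)) := by
    rw [← Real.Gamma_add_one hs.ne', show (m : ℝ) + (α + 1) + 1 = m + (α + 2) by ring]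
    exact Gamma_mul_factorial_le_Gamma_nat_add (by linarith) m
  have hfac : ((2 * m).factorial : ℝ) ≤ 4 ^ m * (m.factorial * m.factorial) := by
    exact_mod_cast factorial_two_mul_le_four_pow_mul m
  have hx : (0 : ℝ) ≤ x ^ (2 * m) := by rw [pow_mul]; positivity
  have hf : (0 : ℝ) < m.factorial := by positivity
  have hden : Real.Gamma (α + 2) * (2 * m).factorial ≤
      (m + (α + 1)) * (4 ^ m * (m.factorial * Real.Gamma (m + (α + 1)))) := by
    calc Real.Gamma (α + 2) * (2 * m).factorial
        ≤ Real.Gamma (α + 2) * (4 ^ m * (m.factorial * m.factorial)) := by gcongr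
      _ = 4 ^ m * m.factorial * (Real.Gamma (α + 2) * m.factorial) := by ring
      _ ≤ 4 ^ m * m.factorial * ((m + (α + 1)) * Real.Gamma (m + (α + 1))) := by gcongr
      _ = _ := by ring
  have h4 : (2 : ℝ) ^ (2 * m) = 4 ^ m := by rw [pow_mul]; norm_num
  rw [div_pow, h4, div_div, inv_mul_eq_div, ← mul_div_assoc, div_div,
    div_le_div_iff₀ (by positivity) (by positivity)]
  calc x ^ (2 * m) * ((2 * m).factorial * Real.Gamma (α + 2))
      = x ^ (2 * m) * (Real.Gamma (α + 2) * (2 * m).factorial) := by ring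
    _ ≤ x ^ (2 * m) * ((m + (α + 1)) * (4 ^ m * (m.factorial * Real.Gamma (m + (α + 1))))) := by
      gcongr
    _ = _ := by ring

lemma le_besselI_coeff {α : ℝ} (hα : -1 < α) {q : ℕ} (hq : α ≤ q) {x : ℝ} (hx : 0 < x) (m : ℕ) :
    (Real.Gamma (α + 1) * x ^ (2 * (q + 1)))⁻¹ *
        (x ^ (2 * (m + (q + 1))) / (2 * (m + (q + 1))).factorial) ≤
      (x / 2) ^ (2 * m) / ((m.factorial : ℝ) * Real.Gamma (m + (α + 1))) := by
  have hm : (0 : ℝ) ≤ m := m.cast_nonneg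
  have hq0 : (0 : ℝ) ≤ q := q.cast_nonneg
  have hG : 0 < Real.Gamma (α + 1) := Real.Gamma_pos_of_pos (by linarith)
  have hGm : 0 < Real.Gamma (m + (α + 1)) := Real.Gamma_pos_of_pos (by linarith)
  have hle := Gamma_nat_add_le_Gamma_mul_factorial (s := α + 1) (by linarith) (k := 2 * q + 1)
    (by push_cast; linarith) m
  have hfac : (4 : ℝ) ^ m * (m.factorial * (m + (2 * q + 1)).factorial) ≤
      (2 * (m + (q + 1))).factorial := by
    rw [show 2 * (m + (q + 1)) = 2 * m + 1 + (2 * q + 1) by ring]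
    exact_mod_cast four_pow_mul_factorial_mul_factorial_add_le m (2 * q + 1)
  have h4 : (2 : ℝ) ^ (2 * m) = 4 ^ m := by rw [pow_mul]; norm_num
  have hden : 4 ^ m * (m.factorial * Real.Gamma (m + (α + 1))) ≤
      Real.Gamma (α + 1) * (2 * (m + (q + 1))).factorial := by
    calc 4 ^ m * (m.factorial * Real.Gamma (m + (α + 1)))
        ≤ 4 ^ m * (m.factorial * (Real.Gamma (α + 1) * (m + (2 * q + 1)).factorial)) := by gcongr
      _ = Real.Gamma (α + 1) * (4 ^ m * (m.factorial * (m + (2 * q + 1)).factorial)) := by ring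
      _ ≤ _ := by gcongr
  have hsplit : (Real.Gamma (α + 1) * x ^ (2 * (q + 1)))⁻¹ *
        (x ^ (2 * (m + (q + 1))) / (2 * (m + (q + 1))).factorial) =
      x ^ (2 * m) / (Real.Gamma (α + 1) * (2 * (m + (q + 1))).factorial) := by
    rw [mul_add 2 m (q + 1), pow_add]
    field_simp
  rw [hsplit, div_pow, h4, div_div]
  gcongr

lemma hasSum_nat_mul_pow_div_factorial_two_mul (x : ℝ) :
    HasSum (fun m : ℕ => (m : ℝ) * (x ^ (2 * m) / (2 * m).factorial)) (x / 2 * Real.sinh x) := by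
  rw [← hasSum_nat_add_iff' 1]
  simp only [Finset.sum_range_one, Nat.cast_zero, zero_mul, sub_zero]
  refine ((Real.hasSum_sinh x).mul_left (x / 2)).congr_fun ?_
  intro m
  rw [show 2 * (m + 1) = 2 * m + 1 + 1 by ring, Nat.factorial_succ (2 * m + 1)]
  push_cast
  field_simp
  ring

lemma hasSum_besselI_majorant (α x : ℝ) :
    HasSum (fun m : ℕ => (Real.Gamma (α + 2))⁻¹ *
        ((m + (α + 1)) * (x ^ (2 * m) / (2 * m).factorial)))
      ((Real.Gamma (α + 2))⁻¹ * (x / 2 * Real.sinh x + (α + 1) * Real.cosh x)) := by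
  refine HasSum.mul_left _ ?_
  simp only [add_mul _ (α + 1)]
  exact (hasSum_nat_mul_pow_div_factorial_two_mul x).add ((Real.hasSum_cosh x).mul_left _)

lemma summable_besselI_coeff {α : ℝ} (hα : -1 < α) (x : ℝ) :
    Summable fun m : ℕ => (x / 2) ^ (2 * m) / ((m.factorial : ℝ) * Real.Gamma (m + (α + 1))) := by
  refine Summable.of_nonneg_of_le (fun m => ?_) (besselI_coeff_le hα x)
    (hasSum_besselI_majorant α x).summable
  have hGm : 0 < Real.Gamma (m + (α + 1)) :=
    Real.Gamma_pos_of_pos (by linarith [m.cast_nonneg (α := ℝ)])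
  rw [pow_mul]
  positivity

lemma besselI_le_mul_exp {α : ℝ} (hα : -1 < α) {x : ℝ} (hx : 1 ≤ x) :
    besselI α x ≤
      (2⁻¹ ^ α * (Real.Gamma (α + 2))⁻¹ * (α + 2)) * x ^ (α + 1) * Real.exp x := by
  have hx0 : 0 < x := by linarith
  have hG : 0 < Real.Gamma (α + 2) := Real.Gamma_pos_of_pos (by linarith)
  have hexp : 0 < Real.exp x := Real.exp_pos x
  have hneg : Real.exp (-x) ≤ Real.exp x := Real.exp_le_exp.2 (by linarith)
  have hsinh : Real.sinh x ≤ Real.exp x := by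
    rw [Real.sinh_eq]; linarith [Real.exp_pos (-x)]
  have hcosh : Real.cosh x ≤ Real.exp x := by
    rw [Real.cosh_eq]; linarith
  have hα' : 0 ≤ α + 1 := by linarith
  rw [besselI_eq_rpow_mul_tsum α hx0]
  calc _ ≤ (x / 2) ^ α *
        ((Real.Gamma (α + 2))⁻¹ * (x / 2 * Real.sinh x + (α + 1) * Real.cosh x)) := by
        gcongr
        rw [← (hasSum_besselI_majorant α x).tsum_eq]
        exact (summable_besselI_coeff hα x).tsum_le_tsum (besselI_coeff_le hα x)
          (hasSum_besselI_majorant α x).summable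
    _ ≤ (x / 2) ^ α * ((Real.Gamma (α + 2))⁻¹ * (x * Real.exp x + (α + 1) * (x * Real.exp x))) := by
        gcongr
        · linarith
        · nlinarith
    _ = _ := by
        rw [div_eq_mul_inv, Real.mul_rpow hx0.le (by norm_num), Real.rpow_add_one hx0.ne']
        ring

lemma eventually_sum_pow_div_factorial_le_exp (r : ℕ) :
    ∀ᶠ x : ℝ in atTop,
      ∑ i ∈ Finset.range r, x ^ (2 * i) / (2 * i).factorial ≤ Real.exp x / 4 := by
  have h : (fun x : ℝ => ∑ i ∈ Finset.range r, x ^ (2 * i) / (2 * i).factorial)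
      =o[atTop] Real.exp := by
    simp only [div_eq_inv_mul]
    exact Asymptotics.IsLittleO.fun_sum fun i _ =>
      (isLittleO_pow_exp_atTop (n := 2 * i)).const_mul_left _
  filter_upwards [h.bound (show (0 : ℝ) < 1 / 4 by norm_num)] with x hx
  rw [Real.norm_eq_abs, Real.norm_of_nonneg (Real.exp_pos x).le] at hx
  linarith [le_abs_self (∑ i ∈ Finset.range r, x ^ (2 * i) / ((2 * i).factorial : ℝ))]

lemma eventually_mul_exp_le_besselI {α : ℝ} (hα : -1 < α) {q : ℕ} (hq : α ≤ q) :
    ∀ᶠ x : ℝ in atTop,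
      (2⁻¹ ^ α * (Real.Gamma (α + 1))⁻¹ * 4⁻¹) * x ^ (α - (2 * (q + 1) : ℕ)) * Real.exp x ≤
        besselI α x := by
  have hG : 0 < Real.Gamma (α + 1) := Real.Gamma_pos_of_pos (by linarith)
  filter_upwards [eventually_sum_pow_div_factorial_le_exp (q + 1), eventually_gt_atTop 0]
    with x hx hx0
  have hsum := (((hasSum_nat_add_iff' (q + 1)).2 (Real.hasSum_cosh x)).mul_left
    (Real.Gamma (α + 1) * x ^ (2 * (q + 1)))⁻¹)
  have hcosh : Real.exp x / 2 ≤ Real.cosh x := by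
    rw [Real.cosh_eq]; linarith [Real.exp_pos (-x)]
  rw [besselI_eq_rpow_mul_tsum α hx0]
  calc _ = (x / 2) ^ α * ((Real.Gamma (α + 1) * x ^ (2 * (q + 1)))⁻¹ * (Real.exp x / 4)) := by
        rw [div_eq_mul_inv x, Real.mul_rpow hx0.le (by norm_num), Real.rpow_sub hx0,
          Real.rpow_natCast]
        field_simp
    _ ≤ (x / 2) ^ α * ((Real.Gamma (α + 1) * x ^ (2 * (q + 1)))⁻¹ *
          (Real.cosh x - ∑ i ∈ Finset.range (q + 1), x ^ (2 * i) / (2 * i).factorial)) := by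
        gcongr
        linarith
    _ ≤ _ := by
        gcongr
        rw [← hsum.tsum_eq]
        exact hsum.summable.tsum_le_tsum (le_besselI_coeff hα hq hx0)
          (summable_besselI_coeff hα x)

lemma tendsto_log_mul_rpow_mul_exp_div_atTop {c : ℝ} (hc : 0 < c) (a : ℝ) :
    Tendsto (fun x => Real.log (c * x ^ a * Real.exp x) / x) atTop (nhds 1) := by
  have hlog : Tendsto (fun x : ℝ => Real.log x / x) atTop (nhds 0) :=
    Real.isLittleO_log_id_atTop.tendsto_div_nhds_zero
  have hconst : Tendsto (fun x : ℝ => Real.log c / x) atTop (nhds 0) :=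
    tendsto_const_nhds.div_atTop tendsto_id
  have h := (hconst.add (hlog.const_mul a)).add_const 1
  simp only [mul_zero, zero_add] at h
  refine h.congr' ?_
  filter_upwards [eventually_gt_atTop 0] with x hx
  rw [Real.log_mul (by positivity) (Real.exp_pos x).ne', Real.log_mul hc.ne' (by positivity),
    Real.log_rpow hx, Real.log_exp]
  field_simp

/-- For `α > -1`, `lim_{x→∞} (log I_α(x)) / x = 1`. -/
theorem tendsto_log_besselI_div_atTop (α : ℝ) (hα : -1 < α) :
    Filter.Tendsto (fun x => Real.log (besselI α x) / x) Filter.atTop (nhds 1) := by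
  obtain ⟨q, hq⟩ := exists_nat_ge α
  have hG₁ : 0 < Real.Gamma (α + 1) := Real.Gamma_pos_of_pos (by linarith)
  have hG₂ : 0 < Real.Gamma (α + 2) := Real.Gamma_pos_of_pos (by linarith)
  have hα₂ : 0 < α + 2 := by linarith
  have hlower := eventually_mul_exp_le_besselI hα hq
  refine tendsto_of_tendsto_of_tendsto_of_le_of_le'
    (tendsto_log_mul_rpow_mul_exp_div_atTop
      (c := 2⁻¹ ^ α * (Real.Gamma (α + 1))⁻¹ * 4⁻¹) (by positivity) (α - (2 * (q + 1) : ℕ)))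
    (tendsto_log_mul_rpow_mul_exp_div_atTop
      (c := 2⁻¹ ^ α * (Real.Gamma (α + 2))⁻¹ * (α + 2)) (by positivity) (α + 1)) ?_ ?_
  · filter_upwards [hlower, eventually_gt_atTop 0] with x hx hx0
    gcongr
  · filter_upwards [hlower, eventually_ge_atTop 1] with x hx hx1
    have hx0 : 0 < x := by linarith
    have hpos : 0 < besselI α x := lt_of_lt_of_le (by positivity) hx
    gcongr
    exact besselI_le_mul_exp hα hx1
end

section
/- Let λ > 0 and suppose either that p ≥ 0 and −1 < ν < 0, or that ν = −1 and p > 0; set γ := 1 + ν/(p+1). Then for every x > 0 the function w defined by w(x) := x^{−ν/2}·I_{ν/(p+1)}((√λ/(p+1))·x^{(p+1)/2}) is differentiable at x with w'(x) = (√λ/2)·x^{(p−ν−1)/2}·I_γ((√λ/(p+1))·x^{(p+1)/2}). -/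
open Real Filter Set

/-- The entire function `z ↦ ∑ zᵐ / (m! Γ(m + α + 1))`, for which
`I_α(x) = (x / 2)^α · besselEntire α ((x / 2)²)`. -/
noncomputable def besselEntire (α z : ℝ) : ℝ :=
  ∑' m : ℕ, 1 / ((m.factorial : ℝ) * Real.Gamma ((m : ℝ) + α + 1)) * z ^ m

theorem summable_besselEntire (α z : ℝ) :
    Summable fun m : ℕ => 1 / ((m.factorial : ℝ) * Real.Gamma ((m : ℝ) + α + 1)) * z ^ m := by
  refine summable_of_ratio_norm_eventually_le (r := 1 / 2) (by norm_num) ?_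
  obtain ⟨N, hN⟩ := exists_nat_ge (max (2 * |z|) (-α))
  filter_upwards [eventually_ge_atTop N] with m hm
  have hm' : (N : ℝ) ≤ m := by exact_mod_cast hm
  have hz : 2 * |z| ≤ m := (le_max_left _ _).trans (hN.trans hm')
  have hα : -α ≤ m := (le_max_right _ _).trans (hN.trans hm')
  have hs : 1 ≤ (m : ℝ) + α + 1 := by linarith
  have hΓ : 0 < Real.Gamma ((m : ℝ) + α + 1) := Real.Gamma_pos_of_pos (by linarith)
  have hΓ' : Real.Gamma (((m + 1 : ℕ) : ℝ) + α + 1)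
      = ((m : ℝ) + α + 1) * Real.Gamma ((m : ℝ) + α + 1) := by
    rw [← Real.Gamma_add_one (by linarith)]
    push_cast
    ring_nf
  have hfac : (0 : ℝ) < m.factorial := by exact_mod_cast m.factorial_pos
  have hstep : 1 / (((m + 1).factorial : ℝ) * Real.Gamma (((m + 1 : ℕ) : ℝ) + α + 1)) * z ^ (m + 1)
      = z / (((m : ℝ) + 1) * ((m : ℝ) + α + 1)) *
        (1 / ((m.factorial : ℝ) * Real.Gamma ((m : ℝ) + α + 1)) * z ^ m) := by
    rw [hΓ', Nat.factorial_succ]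
    have : (m : ℝ) + α + 1 ≠ 0 := by linarith
    push_cast
    field_simp
    ring
  rw [hstep, norm_mul]
  refine mul_le_mul_of_nonneg_right ?_ (norm_nonneg _)
  have hm0 : (0 : ℝ) ≤ m := m.cast_nonneg
  rw [Real.norm_eq_abs, abs_div, abs_of_pos (a := ((m : ℝ) + 1) * ((m : ℝ) + α + 1)) (by positivity),
    div_le_iff₀ (by positivity)]
  nlinarith

theorem hasDerivAt_besselEntire (α z : ℝ) :
    HasDerivAt (besselEntire α) (besselEntire (α + 1) z) z := by
  set a : ℕ → ℝ := fun m => 1 / ((m.factorial : ℝ) * Real.Gamma ((m : ℝ) + α + 1)) with ha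
  have hshift (m : ℕ) : a (m + 1) * ((m + 1 : ℕ) : ℝ)
      = 1 / ((m.factorial : ℝ) * Real.Gamma ((m : ℝ) + (α + 1) + 1)) := by
    have hΓ : ((m + 1 : ℕ) : ℝ) + α + 1 = (m : ℝ) + (α + 1) + 1 := by push_cast; ring
    simp only [ha]
    rw [hΓ, Nat.factorial_succ]
    have : ((m : ℝ) + 1) ≠ 0 := by positivity
    push_cast
    rw [one_div, one_div, mul_inv, mul_inv, mul_inv]
    field_simp
  set R : ℝ := |z| + 1 with hR
  have hu : Summable fun m : ℕ => |a m * (m * R ^ (m - 1))| := by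
    refine (summable_nat_add_iff 1).mp ?_
    refine (summable_besselEntire (α + 1) R).abs.congr fun m => ?_
    rw [← hshift, Nat.add_sub_cancel, mul_assoc]
  have hz : z ∈ Metric.ball (0 : ℝ) R := by simp [hR]
  have hderiv := hasDerivAt_tsum_of_isPreconnected (g := fun m y => a m * y ^ m)
    (g' := fun m y => a m * (m * y ^ (m - 1))) hu Metric.isOpen_ball
    (convex_ball (0 : ℝ) R).isPreconnected
    (fun m y _ => (hasDerivAt_pow m y).const_mul (a m))
    (fun m y hy => by
      have hy' : |y| ≤ |R| := by
        rw [mem_ball_zero_iff, Real.norm_eq_abs] at hy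
        exact hy.le.trans (le_abs_self R)
      simp only [Real.norm_eq_abs, abs_mul, abs_pow]
      gcongr)
    hz (summable_besselEntire α z) hz
  have hsum : Summable fun m : ℕ => a m * (m * z ^ (m - 1)) := by
    refine (summable_nat_add_iff 1).mp ?_
    refine (summable_besselEntire (α + 1) z).congr fun m => ?_
    rw [← hshift, Nat.add_sub_cancel, mul_assoc]
  have hval : ∑' m : ℕ, a m * (m * z ^ (m - 1)) = besselEntire (α + 1) z := by
    rw [hsum.tsum_eq_zero_add, besselEntire]
    simp only [Nat.cast_zero, zero_mul, mul_zero, zero_add]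
    refine tsum_congr fun m => ?_
    rw [← hshift, Nat.add_sub_cancel, mul_assoc]
  exact hval ▸ hderiv

theorem besselI_eq_rpow_mul_besselEntire (α : ℝ) {x : ℝ} (hx : 0 < x) :
    besselI α x = (x / 2) ^ α * besselEntire α ((x / 2) ^ 2) := by
  rw [besselI, besselEntire, ← tsum_mul_left]
  refine tsum_congr fun m => ?_
  rw [Real.rpow_add (by positivity), ← pow_mul, ← Real.rpow_natCast (x / 2) (2 * m)]
  push_cast
  ring

/-- Under the stated conditions on `p`, `ν`, the function
`w(x) = x^{-ν/2} I_{ν/(p+1)}((√λ/(p+1)) x^{(p+1)/2})` is differentiable at every `x > 0`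
with `w'(x) = (√λ/2) x^{(p-ν-1)/2} I_γ((√λ/(p+1)) x^{(p+1)/2})`, where `γ = 1 + ν/(p+1)`. -/
theorem hasDerivAt_besselI_transform (ν p lam : ℝ) (hlam : 0 < lam)
    (h : (0 ≤ p ∧ -1 < ν ∧ ν < 0) ∨ (ν = -1 ∧ 0 < p)) (x : ℝ) (hx : 0 < x) :
    HasDerivAt
      (fun y => y ^ (-ν / 2) * besselI (ν / (p + 1)) (Real.sqrt lam / (p + 1) * y ^ ((p + 1) / 2)))
      (Real.sqrt lam / 2 * x ^ ((p - ν - 1) / 2) *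
        besselI (1 + ν / (p + 1)) (Real.sqrt lam / (p + 1) * x ^ ((p + 1) / 2))) x := by
  have hp : 0 < p + 1 := by rcases h with h | h <;> linarith [h.1, h.2]
  set α := ν / (p + 1) with hα
  set k := Real.sqrt lam / (p + 1) / 2 with hk
  have hk0 : 0 < k := by positivity
  have hαν : (p + 1) / 2 * α = ν / 2 := by rw [hα]; field_simp
  have hbessel (β : ℝ) {y : ℝ} (hy : 0 < y) :
      besselI β (Real.sqrt lam / (p + 1) * y ^ ((p + 1) / 2))
        = k ^ β * y ^ ((p + 1) / 2 * β) * besselEntire β (k ^ 2 * y ^ (p + 1)) := by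
    have hhalf : Real.sqrt lam / (p + 1) * y ^ ((p + 1) / 2) / 2 = k * y ^ ((p + 1) / 2) := by
      rw [hk]; ring
    rw [besselI_eq_rpow_mul_besselEntire β (by positivity), hhalf,
      Real.mul_rpow hk0.le (by positivity), ← Real.rpow_mul hy.le, mul_pow,
      ← Real.rpow_mul_natCast hy.le]
    norm_num
  have hw : (fun y => y ^ (-ν / 2) * besselI α (Real.sqrt lam / (p + 1) * y ^ ((p + 1) / 2)))
      =ᶠ[nhds x] fun y => k ^ α * besselEntire α (k ^ 2 * y ^ (p + 1)) := by
    filter_upwards [eventually_gt_nhds hx] with y hy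
    have hcancel : y ^ (-ν / 2) * y ^ (ν / 2) = 1 := by
      rw [← Real.rpow_add hy, neg_div, neg_add_cancel, Real.rpow_zero]
    rw [hbessel α hy, hαν]
    linear_combination (k ^ α * besselEntire α (k ^ 2 * y ^ (p + 1))) * hcancel
  have hinner : HasDerivAt (fun y : ℝ => k ^ 2 * y ^ (p + 1)) (k ^ 2 * ((p + 1) * x ^ p)) x := by
    simpa using (Real.hasDerivAt_rpow_const (p := p + 1) (Or.inl hx.ne')).const_mul (k ^ 2)
  refine HasDerivAt.congr_of_eventuallyEq ?_ hw
  refine (((hasDerivAt_besselEntire α _).comp x hinner).const_mul (k ^ α)).congr_deriv ?_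
  have hpow : x ^ ((p - ν - 1) / 2) * x ^ ((p + 1) / 2 * (1 + α)) = x ^ p := by
    rw [← Real.rpow_add hx, mul_add, hαν]
    congr 1
    ring
  have hsqrt : Real.sqrt lam / 2 = k * (p + 1) := by rw [hk]; field_simp
  rw [hbessel (1 + α) hx, Real.rpow_add hk0, Real.rpow_one, hsqrt, add_comm α 1]
  linear_combination
    -(k ^ 2 * (p + 1) * k ^ α * besselEntire (1 + α) (k ^ 2 * x ^ (p + 1))) * hpow
end
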